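/- Let U be a countable homogeneous relational structure and let n ∈ ℕ∖{0}. Then U has an n-ary universal homogeneous polymorphism if and only if Age(U) has the AEPⁿ and the HAPⁿ. -/

import Mathlib

set_option autoImplicit false

/-! ## Relational signatures and structures -/

structure RelSig where
  symbols : Type
  arity : symbols → ℕ

structure RelStr (σ : RelSig) where
  carrier : Type
  rel : ∀ s : σ.symbols, Set (Fin (σ.arity s) → carrier)

namespace RelStr

variable {σ : RelSig}

/-- Homomorphisms of relational structures. -/
def IsHom (A B : RelStr σ) (h : A.carrier → B.carrier) : Prop :=
  ∀ (s : σ.symbols) (t : Fin (σ.arity s) → A.carrier),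
    t ∈ A.rel s → (fun j => h (t j)) ∈ B.rel s

/-- Embeddings of relational structures. -/
def IsEmb (A B : RelStr σ) (h : A.carrier → B.carrier) : Prop :=
  Function.Injective h ∧
    ∀ (s : σ.symbols) (t : Fin (σ.arity s) → A.carrier),
      t ∈ A.rel s ↔ (fun j => h (t j)) ∈ B.rel s

/-- Automorphisms: surjective self-embeddings. -/
def IsAut (A : RelStr σ) (h : A.carrier → A.carrier) : Prop :=
  Function.Surjective h ∧ IsEmb A A h

/-- The n-th direct power of a relational structure. -/
def pow (A : RelStr σ) (n : ℕ) : RelStr σ where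
  carrier := Fin n → A.carrier
  rel s := {t | ∀ i : Fin n, (fun j => t j i) ∈ A.rel s}

/-- The direct product of two relational structures. -/
def prod (A B : RelStr σ) : RelStr σ where
  carrier := A.carrier × B.carrier
  rel s := {t | (fun j => (t j).1) ∈ A.rel s ∧ (fun j => (t j).2) ∈ B.rel s}

/-- `A.inAge B` : `B` belongs to the age of `A`, i.e. `B` is finite and embeddable into `A`. -/
def inAge (A B : RelStr σ) : Prop :=
  Finite B.carrier ∧ ∃ h : B.carrier → A.carrier, IsEmb B A h

/-- `Younger A U` : the age of `A` is contained in the age of `U`. -/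
def Younger (A U : RelStr σ) : Prop :=
  ∀ B : RelStr σ, inAge A B → inAge U B

/-- Homogeneity: any two embeddings of a member of the age differ by an automorphism. -/
def IsHomogeneous (U : RelStr σ) : Prop :=
  ∀ B : RelStr σ, inAge U B →
    ∀ ι₁ ι₂ : B.carrier → U.carrier, IsEmb B U ι₁ → IsEmb B U ι₂ →
      ∃ h : U.carrier → U.carrier, IsAut U h ∧ ∀ b, h (ι₁ b) = ι₂ b

/-- ω-categoricity of a countable structure, rendered via the
Engeler–Ryll-Nardzewski–Svenonius theorem: the automorphism group is oligomorphic,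
i.e. has finitely many orbits on `n`-tuples for every `n`. -/
def IsOligomorphic (U : RelStr σ) : Prop :=
  ∀ n : ℕ, ∃ (k : ℕ) (reps : Fin k → (Fin n → U.carrier)),
    ∀ t : Fin n → U.carrier, ∃ (j : Fin k) (h : U.carrier → U.carrier),
      IsAut U h ∧ ∀ i, h (reps j i) = t i

/-- The automorphism group acts transitively on the carrier. -/
def AutTransitive (U : RelStr σ) : Prop :=
  ∀ x y : U.carrier, ∃ h : U.carrier → U.carrier, IsAut U h ∧ h x = y

/-- `D` (with embeddings `g₁, g₂`) is the amalgamated free sum of `B₁` and `B₂`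
over `A` (with embeddings `f₁, f₂`): the carriers are glued exactly along `A`, and
every relation of `D` comes from `B₁` or from `B₂`. -/
def IsFreeAmalgam (A B₁ B₂ D : RelStr σ)
    (f₁ : A.carrier → B₁.carrier) (f₂ : A.carrier → B₂.carrier)
    (g₁ : B₁.carrier → D.carrier) (g₂ : B₂.carrier → D.carrier) : Prop :=
  IsEmb B₁ D g₁ ∧ IsEmb B₂ D g₂ ∧ (∀ a, g₁ (f₁ a) = g₂ (f₂ a)) ∧
    (∀ d : D.carrier, (∃ b, g₁ b = d) ∨ (∃ b, g₂ b = d)) ∧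
    (∀ b₁ b₂, g₁ b₁ = g₂ b₂ → ∃ a, f₁ a = b₁ ∧ f₂ a = b₂) ∧
    ∀ (s : σ.symbols) (t : Fin (σ.arity s) → D.carrier), t ∈ D.rel s →
      (∃ t' ∈ B₁.rel s, ∀ j, g₁ (t' j) = t j) ∨ (∃ t' ∈ B₂.rel s, ∀ j, g₂ (t' j) = t j)

/-- The age of `U` has the free amalgamation property. -/
def AgeFAP (U : RelStr σ) : Prop :=
  ∀ A B₁ B₂ : RelStr σ, inAge U A → inAge U B₁ → inAge U B₂ →
    ∀ (f₁ : A.carrier → B₁.carrier) (f₂ : A.carrier → B₂.carrier),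
      IsEmb A B₁ f₁ → IsEmb A B₂ f₂ →
      ∃ (D : RelStr σ) (g₁ : B₁.carrier → D.carrier) (g₂ : B₂.carrier → D.carrier),
        inAge U D ∧ IsFreeAmalgam A B₁ B₂ D f₁ f₂ g₁ g₂

/-- The age of `U` is closed with respect to finite products. -/
def AgeClosedUnderProducts (U : RelStr σ) : Prop :=
  ∀ A B : RelStr σ, inAge U A → inAge U B → inAge U (A.prod B)

/-- The age of `U` has the homo-amalgamation property (HAP). -/
def AgeHAP (U : RelStr σ) : Prop :=
  ∀ A B C : RelStr σ, inAge U A → inAge U B → inAge U C →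
    ∀ (f : A.carrier → B.carrier) (g : A.carrier → C.carrier),
      IsHom A B f → IsEmb A C g →
      ∃ (D : RelStr σ) (f' : C.carrier → D.carrier) (g' : B.carrier → D.carrier),
        inAge U D ∧ IsHom C D f' ∧ IsEmb B D g' ∧ ∀ a, f' (g a) = g' (f a)

end RelStr

open RelStr

/-! ## Primitive positive formulas -/

/-- Primitive positive formulas with `n` free variables. -/
inductive PP (σ : RelSig) : ℕ → Type
  | eq : ∀ {n : ℕ}, Fin n → Fin n → PP σ n
  | rel : ∀ {n : ℕ} (s : σ.symbols), (Fin (σ.arity s) → Fin n) → PP σ n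
  | and : ∀ {n : ℕ}, PP σ n → PP σ n → PP σ n
  | ex : ∀ {n : ℕ}, PP σ (n + 1) → PP σ n

/-- Satisfaction of a primitive positive formula. -/
def PP.Sat {σ : RelSig} (U : RelStr σ) : ∀ {n : ℕ}, PP σ n → (Fin n → U.carrier) → Prop
  | _, .eq i j, t => t i = t j
  | _, .rel s v, t => (fun k => t (v k)) ∈ U.rel s
  | _, .and φ ψ, t => PP.Sat U φ t ∧ PP.Sat U ψ t
  | _, .ex φ, t => ∃ a : U.carrier, PP.Sat U φ (Fin.snoc t a)

/-- Quantifier-free primitive positive formulas. -/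
def PP.QFree {σ : RelSig} : ∀ {n : ℕ}, PP σ n → Prop
  | _, .eq _ _ => True
  | _, .rel _ _ => True
  | _, .and φ ψ => PP.QFree φ ∧ PP.QFree ψ
  | _, .ex _ => False

/-- `U` has quantifier elimination for primitive positive formulas. -/
def HasPPQE {σ : RelSig} (U : RelStr σ) : Prop :=
  ∀ (n : ℕ) (φ : PP σ n), ∃ ψ : PP σ n, PP.QFree ψ ∧
    ∀ t : Fin n → U.carrier, PP.Sat U φ t ↔ PP.Sat U ψ t

/-! ## Polymorphisms -/

/-- An `n`-ary polymorphism of `U`: a homomorphism `Uⁿ → U`. -/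
def IsPolymorphism {σ : RelSig} (U : RelStr σ) (n : ℕ)
    (u : (Fin n → U.carrier) → U.carrier) : Prop :=
  IsHom (U.pow n) U u

/-- Universal `n`-ary polymorphism. -/
def IsUniversalPolymorphism {σ : RelSig} (U : RelStr σ) (n : ℕ)
    (u : (Fin n → U.carrier) → U.carrier) : Prop :=
  IsPolymorphism U n u ∧
    ∀ A : RelStr σ, Countable A.carrier → Younger A U →
      ∀ f : (Fin n → A.carrier) → U.carrier, IsHom (A.pow n) U f →
        ∃ ι : A.carrier → U.carrier, IsEmb A U ι ∧
          ∀ t : Fin n → A.carrier, f t = u (fun i => ι (t i))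

/-- Homogeneous `n`-ary polymorphism. -/
def IsHomogeneousPolymorphism {σ : RelSig} (U : RelStr σ) (n : ℕ)
    (u : (Fin n → U.carrier) → U.carrier) : Prop :=
  IsPolymorphism U n u ∧
    ∀ A : RelStr σ, inAge U A →
      ∀ f : (Fin n → A.carrier) → U.carrier, IsHom (A.pow n) U f →
        ∀ ι₁ ι₂ : A.carrier → U.carrier, IsEmb A U ι₁ → IsEmb A U ι₂ →
          (∀ t : Fin n → A.carrier, u (fun i => ι₁ (t i)) = f t) →
          (∀ t : Fin n → A.carrier, u (fun i => ι₂ (t i)) = f t) →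
          ∃ h : U.carrier → U.carrier, IsAut U h ∧ (∀ a, h (ι₁ a) = ι₂ a) ∧
            ∀ t : Fin n → U.carrier, u (fun i => h (t i)) = u t

/-! ## Clones of finitary operations

Operations of arity `n + 1` are indexed by `n : ℕ`, so that all arities are `≥ 1`. -/

structure Clone (U : Type) where
  ops : ∀ n : ℕ, Set ((Fin (n + 1) → U) → U)
  proj_mem : ∀ (n : ℕ) (i : Fin (n + 1)), (fun x => x i) ∈ ops n
  comp_mem : ∀ {n m : ℕ} (f : (Fin (n + 1) → U) → U) (g : Fin (n + 1) → (Fin (m + 1) → U) → U),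
      f ∈ ops n → (∀ i, g i ∈ ops m) → (fun x => f fun i => g i x) ∈ ops m

/-- The underlying set of a clone: the disjoint sum of its arity fibers. -/
abbrev Clone.Elem {U : Type} (C : Clone U) : Type := Σ n : ℕ, ↥(C.ops n)

/-- The polymorphism clone of a relational structure. -/
def polClone {σ : RelSig} (U : RelStr σ) : Clone U.carrier where
  ops n := {f | IsPolymorphism U (n + 1) f}
  proj_mem n i := fun s t ht => ht i
  comp_mem f g hf hg := fun s t ht => hf s (fun j i => g i (t j)) (fun i => hg i s t ht)

/-- The topology of pointwise convergence (the carrier being discrete) on the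
space of `n+1`-ary operations on `U`. -/
def fnTop (U : Type) (n : ℕ) : TopologicalSpace ((Fin (n + 1) → U) → U) :=
  letI : TopologicalSpace U := ⊥
  inferInstance

/-- The topology of pointwise convergence on an arity fiber of a clone. -/
def opsTop {U : Type} (C : Clone U) (n : ℕ) : TopologicalSpace ↥(C.ops n) :=
  letI : TopologicalSpace U := ⊥
  inferInstance

/-- The canonical topology on a clone: the sum over all arities of the topologies
of pointwise convergence. -/
def cloneTop {U : Type} (C : Clone U) : TopologicalSpace C.Elem :=
  letI : TopologicalSpace U := ⊥
  inferInstance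

/-- Clone homomorphisms: arity preserving maps preserving projections and composition. -/
structure CloneHom {U V : Type} (C : Clone U) (D : Clone V) where
  app : ∀ n : ℕ, ↥(C.ops n) → ↥(D.ops n)
  map_proj : ∀ (n : ℕ) (i : Fin (n + 1)),
    (app n ⟨fun x => x i, C.proj_mem n i⟩).val = fun x => x i
  map_comp : ∀ (n m : ℕ) (f : ↥(C.ops n)) (g : Fin (n + 1) → ↥(C.ops m)),
    (app m ⟨fun x => f.val fun i => (g i).val x,
        C.comp_mem f.val (fun i => (g i).val) f.property (fun i => (g i).property)⟩).val
      = fun x => (app n f).val fun i => (app m (g i)).val x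

/-- The action of a clone homomorphism on the underlying sets. -/
def CloneHom.elemMap {U V : Type} {C : Clone U} {D : Clone V} (h : CloneHom C D) :
    C.Elem → D.Elem :=
  fun p => ⟨p.1, h.app p.1 p.2⟩

/-- Application of a unary operation (in the `Fin 1` encoding) to a point. -/
def ap1 {U : Type} (φ : (Fin 1 → U) → U) (u : U) : U := φ (fun _ => u)

/-- The group of units of the unary part of a clone. -/
def cloneUnits {U : Type} (C : Clone U) : Set ((Fin 1 → U) → U) :=
  {φ | φ ∈ C.ops 0 ∧ ∃ ψ ∈ C.ops 0, (∀ u, ap1 φ (ap1 ψ u) = u) ∧ ∀ u, ap1 ψ (ap1 φ u) = u}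

/-- The closure of the group of units inside the unary part of a clone. -/
def unitClosure {U : Type} (C : Clone U) : Set ((Fin 1 → U) → U) :=
  C.ops 0 ∩ @closure _ (fnTop U 0) (cloneUnits C)

/-- Cauchy sequences of functions with respect to the complete ultrametric of
pointwise convergence (discrete codomain): at every argument, the sequence of
values is eventually constant. -/
def PtwCauchy {α U : Type} (g : ℕ → α → U) : Prop :=
  ∀ x : α, ∃ N : ℕ, ∀ m, N ≤ m → ∀ m', N ≤ m' → g m x = g m' x

/-- Pointwise convergence of a sequence of functions (discrete codomain). -/
def PtwConv {α β : Type} (g : ℕ → α → β) (f : α → β) : Prop :=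
  ∀ x : α, ∃ N : ℕ, ∀ j, N ≤ j → g j x = f x

/-- A strong gate covering of a clone. -/
def StrongGateCovering {U : Type} (C : Clone U) : Prop :=
  ∃ (𝒰 : Set (Set C.Elem)) (F : ∀ V ∈ 𝒰, C.Elem),
    (∀ V ∈ 𝒰, @IsOpen _ (cloneTop C) V) ∧
    (∀ p : C.Elem, ∃ V ∈ 𝒰, p ∈ V) ∧
    (∀ V (hV : V ∈ 𝒰), F V hV ∈ V) ∧
    ∀ V (hV : V ∈ 𝒰) (k : ℕ) (g : ℕ → ↥(C.ops k)),
      (∀ j : ℕ, (⟨k, g j⟩ : C.Elem) ∈ V) →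
      PtwCauchy (fun j => (g j).val) →
      ∃ fV : ↥(C.ops k), F V hV = ⟨k, fV⟩ ∧
        ∃ (κ : ℕ → (Fin 1 → U) → U) (ι : Fin (k + 1) → ℕ → (Fin 1 → U) → U),
          (∀ j, κ j ∈ unitClosure C) ∧ (∀ i j, ι i j ∈ unitClosure C) ∧
          PtwCauchy κ ∧ (∀ i, PtwCauchy (ι i)) ∧
          ∀ (j : ℕ) (x : Fin (k + 1) → U),
            (g j).val x = ap1 (κ j) (fV.val fun i => ap1 (ι i j) (x i))

/-- A closed (sub)clone of the clone of all operations. -/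
def IsClosedClone {U : Type} (C : Clone U) : Prop :=
  ∀ n : ℕ, @IsClosed _ (fnTop U n) (C.ops n)

/-! ## Posets as relational structures -/

/-- The signature with a single binary relation symbol. -/
def sigOrd : RelSig := ⟨Unit, fun _ => 2⟩

/-- A (reflexive) partial order viewed as a relational structure. -/
def ordStruc (P : Type) [PartialOrder P] : RelStr sigOrd where
  carrier := P
  rel _ := {t : Fin 2 → P | t 0 ≤ t 1}

/-! ## The amalgamation extension property AEPⁿ and the homo-amalgamation property HAPⁿ -/

/-- A class `𝒞` of relational structures has the AEPⁿ. -/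
def HasAEPn {σ : RelSig} (𝒞 : RelStr σ → Prop) (n : ℕ) : Prop :=
  ∀ A B₁ B₂ T : RelStr σ, 𝒞 A → 𝒞 B₁ → 𝒞 B₂ → 𝒞 T →
    ∀ (f₁ : A.carrier → B₁.carrier) (f₂ : A.carrier → B₂.carrier),
      RelStr.IsEmb A B₁ f₁ → RelStr.IsEmb A B₂ f₂ →
      ∀ (h₁ : (Fin n → B₁.carrier) → T.carrier) (h₂ : (Fin n → B₂.carrier) → T.carrier),
        RelStr.IsHom (B₁.pow n) T h₁ → RelStr.IsHom (B₂.pow n) T h₂ →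
        (∀ t : Fin n → A.carrier, h₁ (fun i => f₁ (t i)) = h₂ (fun i => f₂ (t i))) →
        ∃ (C T' : RelStr σ) (g₁ : B₁.carrier → C.carrier) (g₂ : B₂.carrier → C.carrier)
            (k : T.carrier → T'.carrier) (h : (Fin n → C.carrier) → T'.carrier),
          𝒞 C ∧ 𝒞 T' ∧ RelStr.IsEmb B₁ C g₁ ∧ RelStr.IsEmb B₂ C g₂ ∧
            (∀ a, g₁ (f₁ a) = g₂ (f₂ a)) ∧ RelStr.IsEmb T T' k ∧
            RelStr.IsHom (C.pow n) T' h ∧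
            (∀ t : Fin n → B₁.carrier, h (fun i => g₁ (t i)) = k (h₁ t)) ∧
            (∀ t : Fin n → B₂.carrier, h (fun i => g₂ (t i)) = k (h₂ t))

/-- A class `𝒞` of relational structures has the HAPⁿ. -/
def HasHAPn {σ : RelSig} (𝒞 : RelStr σ → Prop) (n : ℕ) : Prop :=
  ∀ A B T₁ : RelStr σ, 𝒞 A → 𝒞 B → 𝒞 T₁ →
    ∀ (g : A.carrier → B.carrier) (a : (Fin n → A.carrier) → T₁.carrier),
      RelStr.IsEmb A B g → RelStr.IsHom (A.pow n) T₁ a →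
      ∃ (T₂ : RelStr σ) (h : T₁.carrier → T₂.carrier) (b : (Fin n → B.carrier) → T₂.carrier),
        𝒞 T₂ ∧ RelStr.IsEmb T₁ T₂ h ∧ RelStr.IsHom (B.pow n) T₂ b ∧
          ∀ t : Fin n → A.carrier, b (fun i => g (t i)) = h (a t)

/-- Rasiowa–Sikorski: a monotone sequence from `p` meeting countably many cofinal sets. -/
theorem exists_monotone_seq_meeting {P ι : Type*} [Preorder P] [Countable ι] (p : P)
    (D : ι → Set P) (hD : ∀ i x, ∃ y ∈ D i, x ≤ y) :
    ∃ s : ℕ → P, Monotone s ∧ s 0 = p ∧ ∀ i, ∃ k, s k ∈ D i := by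
  let := Encodable.ofCountable ι
  let 𝒟 : ι → Order.Cofinal P := fun i => ⟨D i, hD i⟩
  exact ⟨Order.sequenceOfCofinals p 𝒟, Order.sequenceOfCofinals.monotone p 𝒟, rfl,
    fun i => ⟨_, Order.sequenceOfCofinals.encode_mem p 𝒟 i⟩⟩

/-- A finite family in the union of an increasing sequence of sets lies in one of them. -/
theorem exists_forall_mem_of_monotone {X ι : Type*} [Finite ι] {S : ℕ → Set X}
    (hS : Monotone S) (t : ι → X) (ht : ∀ i, ∃ k, t i ∈ S k) : ∃ k, ∀ i, t i ∈ S k := by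
  choose k hk using ht
  obtain ⟨N, hN⟩ := (Set.finite_range k).bddAbove
  exact ⟨N, fun i => hS (hN ⟨i, rfl⟩) (hk i)⟩

namespace RelStr

variable {σ : RelSig} {A B C U : RelStr σ} {n : ℕ}

theorem IsEmb.comp {g : B.carrier → C.carrier} {f : A.carrier → B.carrier}
    (hg : IsEmb B C g) (hf : IsEmb A B f) : IsEmb A C (fun a => g (f a)) :=
  ⟨hg.1.comp hf.1, fun s t => (hf.2 s t).trans (hg.2 s _)⟩

theorem IsHom.comp {g : B.carrier → C.carrier} {f : A.carrier → B.carrier}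
    (hg : IsHom B C g) (hf : IsHom A B f) : IsHom A C (fun a => g (f a)) :=
  fun s t ht => hg s _ (hf s t ht)

theorem IsEmb.isHom {f : A.carrier → B.carrier} (hf : IsEmb A B f) : IsHom A B f :=
  fun s t => (hf.2 s t).1

theorem IsHom.pow {f : A.carrier → B.carrier} (hf : IsHom A B f) (n : ℕ) :
    IsHom (A.pow n) (B.pow n) (fun t i => f (t i)) :=
  fun s _ ht i => hf s _ (ht i)

/-- The structure pulled back along a map into the carrier of `U`. -/
def induced (U : RelStr σ) {X : Type} (j : X → U.carrier) : RelStr σ where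
  carrier := X
  rel s := {t | (fun i => j (t i)) ∈ U.rel s}

theorem isEmb_induced {X : Type} {j : X → U.carrier} (hj : Function.Injective j) :
    IsEmb (U.induced j) U j :=
  ⟨hj, fun _ _ => Iff.rfl⟩

theorem isEmb_induced_val (S : Set U.carrier) :
    IsEmb (U.induced (Subtype.val : S → U.carrier)) U Subtype.val :=
  isEmb_induced Subtype.val_injective

theorem IsEmb.codRestrict {f : A.carrier → U.carrier} (hf : IsEmb A U f) {S : Set U.carrier}
    (h : ∀ a, f a ∈ S) : IsEmb A (U.induced (Subtype.val : S → U.carrier)) (fun a => ⟨f a, h a⟩) :=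
  ⟨fun _ _ hab => hf.1 (congrArg Subtype.val hab), hf.2⟩

theorem IsHom.codRestrict {f : A.carrier → U.carrier} (hf : IsHom A U f) {S : Set U.carrier}
    (h : ∀ a, f a ∈ S) : IsHom A (U.induced (Subtype.val : S → U.carrier)) (fun a => ⟨f a, h a⟩) :=
  hf

theorem inAge_induced {S : Set U.carrier} (hS : S.Finite) :
    inAge U (U.induced (Subtype.val : S → U.carrier)) :=
  ⟨hS, _, isEmb_induced_val S⟩

theorem inAge.mono (hB : inAge U B) (hA : inAge B A) : inAge U A :=
  ⟨hA.1, _, hB.2.choose_spec.comp hA.2.choose_spec⟩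

theorem inAge.younger (hA : inAge U A) : Younger A U := fun _ => hA.mono

/-- Members of the age of a homogeneous structure embed over any given embedded substructure. -/
theorem IsHomogeneous.exists_extend (hU : IsHomogeneous U) (hA : inAge U A) (hB : inAge U B)
    {k : A.carrier → B.carrier} (hk : IsEmb A B k) {i : A.carrier → U.carrier}
    (hi : IsEmb A U i) : ∃ j : B.carrier → U.carrier, IsEmb B U j ∧ ∀ a, j (k a) = i a := by
  obtain ⟨-, j, hj⟩ := hB
  obtain ⟨α, hα, h⟩ := hU A hA _ i (hj.comp hk) hi
  exact ⟨_, hα.2.comp hj, h⟩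

/-- The HAPⁿ of the age with target `U` itself: homomorphisms from powers extend. -/
theorem exists_hom_extend (hU : IsHomogeneous U) (H : HasHAPn (inAge U) n)
    (hA : inAge U A) (hB : inAge U B) {g : A.carrier → B.carrier} (hg : IsEmb A B g)
    {a : (Fin n → A.carrier) → U.carrier} (ha : IsHom (A.pow n) U a) :
    ∃ b : (Fin n → B.carrier) → U.carrier, IsHom (B.pow n) U b ∧
      ∀ t : Fin n → A.carrier, b (fun i => g (t i)) = a t := by
  have := hA.1
  have hT := inAge_induced (U := U) (Set.finite_range a)
  obtain ⟨T₂, h, b, hT₂, hh, hb, hba⟩ := H A B _ hA hB hT g _ hg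
    (IsHom.codRestrict (A := A.pow n) ha (S := Set.range a) fun t => ⟨t, rfl⟩)
  obtain ⟨j, hj, hjh⟩ := hU.exists_extend hT hT₂ hh (isEmb_induced_val _)
  exact ⟨_, hj.isHom.comp hb, fun t => (congrArg j (hba t)).trans (hjh _)⟩

/-- The AEPⁿ of the age with target `U` itself. -/
theorem exists_amalgam_hom {B₁ B₂ : RelStr σ} (hU : IsHomogeneous U) (H : HasAEPn (inAge U) n)
    (hA : inAge U A) (hB₁ : inAge U B₁) (hB₂ : inAge U B₂)
    {f₁ : A.carrier → B₁.carrier} {f₂ : A.carrier → B₂.carrier}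
    (hf₁ : IsEmb A B₁ f₁) (hf₂ : IsEmb A B₂ f₂)
    {h₁ : (Fin n → B₁.carrier) → U.carrier} {h₂ : (Fin n → B₂.carrier) → U.carrier}
    (hh₁ : IsHom (B₁.pow n) U h₁) (hh₂ : IsHom (B₂.pow n) U h₂)
    (hcomm : ∀ t : Fin n → A.carrier, h₁ (fun i => f₁ (t i)) = h₂ (fun i => f₂ (t i))) :
    ∃ (C : RelStr σ) (g₁ : B₁.carrier → C.carrier) (g₂ : B₂.carrier → C.carrier)
      (h : (Fin n → C.carrier) → U.carrier), inAge U C ∧ IsEmb B₁ C g₁ ∧ IsEmb B₂ C g₂ ∧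
        (∀ a, g₁ (f₁ a) = g₂ (f₂ a)) ∧ IsHom (C.pow n) U h ∧
        (∀ t : Fin n → B₁.carrier, h (fun i => g₁ (t i)) = h₁ t) ∧
        (∀ t : Fin n → B₂.carrier, h (fun i => g₂ (t i)) = h₂ t) := by
  have := hB₁.1
  have := hB₂.1
  have hT := inAge_induced (U := U) ((Set.finite_range h₁).union (Set.finite_range h₂))
  obtain ⟨C, T', g₁, g₂, k, h, hC, hT', hg₁, hg₂, hg, hk, hh, e₁, e₂⟩ :=
    H A B₁ B₂ _ hA hB₁ hB₂ hT f₁ f₂ hf₁ hf₂ _ _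
      (IsHom.codRestrict (A := B₁.pow n) hh₁ fun t => Or.inl ⟨t, rfl⟩)
      (IsHom.codRestrict (A := B₂.pow n) hh₂ fun t => Or.inr ⟨t, rfl⟩)
      (fun t => Subtype.ext (hcomm t))
  obtain ⟨j, hj, hjk⟩ := hU.exists_extend hT hT' hk (isEmb_induced_val _)
  exact ⟨C, g₁, g₂, _, hC, hg₁, hg₂, hg, hj.isHom.comp hh,
    fun t => (congrArg j (e₁ t)).trans (hjk _), fun t => (congrArg j (e₂ t)).trans (hjk _)⟩

/-! ### Necessity -/

theorem hasHAPn_of_universal (hU : IsHomogeneous U) {u : (Fin n → U.carrier) → U.carrier}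
    (hu : IsUniversalPolymorphism U n u) : HasHAPn (inAge U) n := by
  rintro A B T₁ hA hB ⟨hT, j, hj⟩ g a hg ha
  have := hA.1
  have := hB.1
  obtain ⟨ι, hι, hιf⟩ := hu.2 A Finite.to_countable hA.younger _ (hj.isHom.comp ha)
  obtain ⟨ι', hι', hιg⟩ := hU.exists_extend hA hB hg hι
  have hb : IsHom (B.pow n) U (fun t => u fun i => ι' (t i)) :=
    IsHom.comp (B := U.pow n) hu.1 (hι'.isHom.pow n)
  refine ⟨_, _, _, inAge_induced (S := Set.range j ∪ Set.range fun t : Fin n → B.carrier =>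
    u fun i => ι' (t i)) ((Set.finite_range _).union (Set.finite_range _)),
    hj.codRestrict fun x => Or.inl ⟨x, rfl⟩,
    IsHom.codRestrict (A := B.pow n) hb fun t => Or.inr ⟨t, rfl⟩, fun t => Subtype.ext ?_⟩
  simp only [hιg]
  exact (hιf t).symm

theorem hasAEPn_of_universal_homogeneous {u : (Fin n → U.carrier) → U.carrier}
    (hu : IsUniversalPolymorphism U n u) (hu' : IsHomogeneousPolymorphism U n u) :
    HasAEPn (inAge U) n := by
  rintro A B₁ B₂ T hA hB₁ hB₂ ⟨hT, j, hj⟩ f₁ f₂ hf₁ hf₂ h₁ h₂ hh₁ hh₂ hcomm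
  have := hB₁.1
  have := hB₂.1
  obtain ⟨ι₁, hι₁, e₁⟩ := hu.2 B₁ Finite.to_countable hB₁.younger _ (hj.isHom.comp hh₁)
  obtain ⟨ι₂, hι₂, e₂⟩ := hu.2 B₂ Finite.to_countable hB₂.younger _ (hj.isHom.comp hh₂)
  obtain ⟨α, hα, hαι, hαu⟩ := hu'.2 A hA _
    (hj.isHom.comp (IsHom.comp (B := B₁.pow n) hh₁ (hf₁.isHom.pow n)))
    _ _ (hι₁.comp hf₁) (hι₂.comp hf₂) (fun t => (e₁ _).symm)
    (fun t => (e₂ fun i => f₂ (t i)).symm.trans (congrArg j (hcomm t).symm))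
  let S : Set U.carrier := Set.range (fun b => α (ι₁ b)) ∪ Set.range ι₂
  have hS : S.Finite := (Set.finite_range _).union (Set.finite_range _)
  have := hS.to_subtype
  let v : (Fin n → S) → U.carrier := fun t => u fun i => (t i).val
  have hv : IsHom ((U.induced (Subtype.val : S → U.carrier)).pow n) U v :=
    IsHom.comp (B := U.pow n) hu.1 ((isEmb_induced_val S).isHom.pow n)
  refine ⟨U.induced (Subtype.val : S → U.carrier), _, fun b => ⟨α (ι₁ b), Or.inl ⟨b, rfl⟩⟩,
    fun b => ⟨ι₂ b, Or.inr ⟨b, rfl⟩⟩, _, _,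
    inAge_induced hS, inAge_induced (S := Set.range j ∪ Set.range v)
      ((Set.finite_range _).union (Set.finite_range _)),
    (hα.2.comp hι₁).codRestrict _, hι₂.codRestrict _, fun a => Subtype.ext (hαι a),
    hj.codRestrict fun x => Or.inl ⟨x, rfl⟩,
    hv.codRestrict fun t => Or.inr ⟨t, rfl⟩, fun t => Subtype.ext ?_, fun t => Subtype.ext ?_⟩
  · exact (hαu _).trans (e₁ t).symm
  · exact (e₂ t).symm

/-! ### Partial isomorphisms over a polymorphism -/

/-- `R` is a partial isomorphism from `A` to `B` compatible with maps from the `n`-th powers. -/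
structure IsPartialIso {X : Type} (A B : RelStr σ) (f : (Fin n → A.carrier) → X)
    (g : (Fin n → B.carrier) → X) (R : Set (A.carrier × B.carrier)) : Prop where
  inj : ∀ p ∈ R, ∀ q ∈ R, p.1 = q.1 ↔ p.2 = q.2
  rel : ∀ (s : σ.symbols) (t : Fin (σ.arity s) → A.carrier × B.carrier), (∀ j, t j ∈ R) →
    ((fun j => (t j).1) ∈ A.rel s ↔ (fun j => (t j).2) ∈ B.rel s)
  compat : ∀ t : Fin n → A.carrier × B.carrier, (∀ i, t i ∈ R) →
    f (fun i => (t i).1) = g (fun i => (t i).2)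

section PartialIso

variable {X : Type} {f : (Fin n → A.carrier) → X} {g : (Fin n → B.carrier) → X}

theorem IsPartialIso.swap {R : Set (A.carrier × B.carrier)} (h : IsPartialIso A B f g R) :
    IsPartialIso B A g f (Prod.swap ⁻¹' R) where
  inj _ hp _ hq := (h.inj _ hp _ hq).symm
  rel s t ht := (h.rel s (fun j => (t j).swap) ht).symm
  compat t ht := (h.compat (fun j => (t j).swap) ht).symm

theorem IsPartialIso.iUnion {R : ℕ → Set (A.carrier × B.carrier)} (hR : Monotone R)
    (h : ∀ k, IsPartialIso A B f g (R k)) : IsPartialIso A B f g (⋃ k, R k) where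
  inj p hp q hq := by
    obtain ⟨k, hk⟩ := exists_forall_mem_of_monotone hR ![p, q] (by
      simpa [Fin.forall_fin_two] using ⟨Set.mem_iUnion.1 hp, Set.mem_iUnion.1 hq⟩)
    exact (h k).inj p (hk 0) q (hk 1)
  rel s t ht := by
    obtain ⟨k, hk⟩ := exists_forall_mem_of_monotone hR t fun j => Set.mem_iUnion.1 (ht j)
    exact (h k).rel s t hk
  compat t ht := by
    obtain ⟨k, hk⟩ := exists_forall_mem_of_monotone hR t fun j => Set.mem_iUnion.1 (ht j)
    exact (h k).compat t hk

/-- The generic partial isomorphism meeting countably many density requirements. -/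
theorem IsPartialIso.exists_generic {ι : Type} [Countable ι] {R₀ : Set (A.carrier × B.carrier)}
    (hfin : R₀.Finite) (h₀ : IsPartialIso A B f g R₀) (Q : ι → Set (A.carrier × B.carrier))
    (hQ : ∀ i R, R.Finite → IsPartialIso A B f g R →
      ∃ p ∈ Q i, IsPartialIso A B f g (insert p R)) :
    ∃ R, R₀ ⊆ R ∧ IsPartialIso A B f g R ∧ ∀ i, ∃ p ∈ Q i, p ∈ R := by
  obtain ⟨s, hs, hs0, hsQ⟩ := exists_monotone_seq_meeting
    (P := {R : Set (A.carrier × B.carrier) // R.Finite ∧ IsPartialIso A B f g R})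
    ⟨R₀, hfin, h₀⟩ (fun i : ι => {R | ∃ p ∈ Q i, p ∈ R.val}) (by
      rintro i ⟨R, hR, hR'⟩
      obtain ⟨p, hp, hpR⟩ := hQ i R hR hR'
      exact ⟨⟨insert p R, hR.insert p, hpR⟩, ⟨p, hp, Set.mem_insert _ _⟩, Set.subset_insert _ _⟩)
  refine ⟨⋃ k, (s k).val, ?_, .iUnion (fun _ _ hkl => hs hkl) fun k => (s k).2.2, fun i => ?_⟩
  · exact (congrArg Subtype.val hs0).symm.subset.trans
      (Set.subset_iUnion (fun k => (s k).val) 0)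
  · obtain ⟨k, p, hp, hpk⟩ := hsQ i
    exact ⟨p, hp, Set.mem_iUnion.2 ⟨k, hpk⟩⟩

theorem IsPartialIso.exists_isEmb {R : Set (A.carrier × B.carrier)}
    (h : IsPartialIso A B f g R) (htot : ∀ a, ∃ b, (a, b) ∈ R) :
    ∃ ι : A.carrier → B.carrier, IsEmb A B ι ∧ (∀ p ∈ R, ι p.1 = p.2) ∧
      ∀ t : Fin n → A.carrier, f t = g fun i => ι (t i) := by
  choose ι hι using htot
  exact ⟨ι, ⟨fun a b hab => (h.inj _ (hι a) _ (hι b)).2 hab,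
    fun s t => h.rel s (fun j => (t j, ι (t j))) fun j => hι _⟩,
    fun p hp => (h.inj _ (hι p.1) _ hp).1 rfl,
    fun t => h.compat (fun j => (t j, ι (t j))) fun j => hι _⟩

theorem IsEmb.isPartialIso {C : RelStr σ} {i : C.carrier → A.carrier} {j : C.carrier → B.carrier}
    (hi : IsEmb C A i) (hj : IsEmb C B j)
    (hfg : ∀ t : Fin n → C.carrier, f (fun k => i (t k)) = g (fun k => j (t k))) :
    IsPartialIso A B f g (Set.range fun c => (i c, j c)) where
  inj := by
    rintro _ ⟨a, rfl⟩ _ ⟨b, rfl⟩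
    exact hi.1.eq_iff.trans hj.1.eq_iff.symm
  rel s t ht := by
    choose c hc using ht
    obtain rfl : (fun k => (i (c k), j (c k))) = t := funext hc
    exact (hi.2 s c).symm.trans (hj.2 s c)
  compat t ht := by
    choose c hc using ht
    obtain rfl : (fun k => (i (c k), j (c k))) = t := funext hc
    exact hfg c

theorem IsPartialIso.mono {R R' : Set (A.carrier × B.carrier)} (h : IsPartialIso A B f g R)
    (hR : R' ⊆ R) : IsPartialIso A B f g R' where
  inj _ hp _ hq := h.inj _ (hR hp) _ (hR hq)
  rel s t ht := h.rel s t fun j => hR (ht j)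
  compat t ht := h.compat t fun j => hR (ht j)

end PartialIso

/-- The extension property of the Fraïssé limit in the category of pairs consisting of a member
`B` of the age and a homomorphism `Bⁿ → U`. -/
def HasExtension (U : RelStr σ) (n : ℕ) (u : (Fin n → U.carrier) → U.carrier) : Prop :=
  ∀ (B : RelStr σ) (b : (Fin n → B.carrier) → U.carrier) (S : Set B.carrier)
    (e : B.carrier → U.carrier), inAge U B → IsHom (B.pow n) U b →
    IsEmb (B.induced (Subtype.val : S → B.carrier)) U (fun x => e x.val) →
    (∀ t : Fin n → S, b (fun i => (t i).val) = u (fun i => e (t i).val)) →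
    ∃ ι : B.carrier → U.carrier, IsEmb B U ι ∧ (∀ x ∈ S, ι x = e x) ∧
      ∀ t : Fin n → B.carrier, b t = u fun i => ι (t i)

theorem HasExtension.exists_insert {u : (Fin n → U.carrier) → U.carrier}
    (hu : HasExtension U n u) (hA : Younger A U) {f : (Fin n → A.carrier) → U.carrier}
    (hf : IsHom (A.pow n) U f) {R : Set (A.carrier × U.carrier)} (hfin : R.Finite)
    (hR : IsPartialIso A U f u R) (a : A.carrier) :
    ∃ b, IsPartialIso A U f u (insert (a, b) R) := by
  classical
  let Y : Set A.carrier := insert a (Prod.fst '' R)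
  have hY : inAge U (A.induced (Subtype.val : Y → A.carrier)) :=
    hA _ (inAge_induced ((hfin.image _).insert a))
  obtain ⟨-, jB, -⟩ := id hY
  let S : Set Y := {x | ∃ b, (x.val, b) ∈ R}
  let e : Y → U.carrier := fun x => if h : x ∈ S then h.choose else jB x
  have he : ∀ x ∈ S, (x.val, e x) ∈ R := fun x hx => by
    simp only [e, dif_pos hx]
    exact hx.choose_spec
  have hval : IsEmb _ A _ := isEmb_induced_val Y
  obtain ⟨ι, hι, hιe, hιu⟩ := hu (A.induced (Subtype.val : Y → A.carrier))
    (fun t : Fin n → Y => f fun i => (t i).val) S e hY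
    (IsHom.comp (B := A.pow n) hf (hval.isHom.pow n))
    ⟨fun x y hxy => Subtype.ext (Subtype.ext
        ((hR.inj _ (he x.1 x.2) _ (he y.1 y.2)).2 hxy)),
      fun s t => hR.rel s (fun j => ((t j).val.val, e (t j).val)) fun j => he _ (t j).2⟩
    (fun t => hR.compat (fun j => ((t j).val.val, e (t j).val)) fun j => he _ (t j).2)
  refine ⟨ι ⟨a, Set.mem_insert _ _⟩, (hval.isPartialIso hι hιu).mono (Set.insert_subset ?_ ?_)⟩
  · exact ⟨⟨a, Set.mem_insert _ _⟩, rfl⟩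
  · rintro ⟨x, y⟩ hxy
    have hx : x ∈ Y := Set.mem_insert_of_mem _ ⟨_, hxy, rfl⟩
    have hS : (⟨x, hx⟩ : Y) ∈ S := ⟨y, hxy⟩
    exact ⟨⟨x, hx⟩, Prod.ext rfl ((hιe _ hS).trans ((hR.inj _ (he _ hS) _ hxy).1 rfl))⟩

theorem HasExtension.isUniversalPolymorphism (hn : 0 < n) {u : (Fin n → U.carrier) → U.carrier}
    (hu : HasExtension U n u) (hpol : IsPolymorphism U n u) : IsUniversalPolymorphism U n u := by
  refine ⟨hpol, fun A _ hA f hf => ?_⟩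
  obtain ⟨-, j₀, hj₀⟩ := hA _ (inAge_induced (U := A) Set.finite_empty)
  have h₀ : IsPartialIso A U f u ∅ := by
    refine ((isEmb_induced_val _).isPartialIso hj₀ fun t => (t ⟨0, hn⟩).2.elim).mono ?_
    exact Set.empty_subset _
  obtain ⟨R, -, hR, hRa⟩ := h₀.exists_generic Set.finite_empty
    (fun a : A.carrier => {p | p.1 = a}) (fun a R hfin hR => by
      obtain ⟨b, hb⟩ := hu.exists_insert hA hf hfin hR a
      exact ⟨(a, b), rfl, hb⟩)
  obtain ⟨ι, hι, -, h⟩ := hR.exists_isEmb fun a => by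
    obtain ⟨⟨_, b⟩, rfl, hb⟩ := hRa a
    exact ⟨b, hb⟩
  exact ⟨ι, hι, h⟩

theorem HasExtension.isHomogeneousPolymorphism [Countable U.carrier]
    {u : (Fin n → U.carrier) → U.carrier}
    (hu : HasExtension U n u) (hpol : IsPolymorphism U n u) :
    IsHomogeneousPolymorphism U n u := by
  refine ⟨hpol, fun A hA f _ ι₁ ι₂ hι₁ hι₂ h₁ h₂ => ?_⟩
  have := hA.1
  have hY : Younger U U := fun _ => id
  obtain ⟨R, hR₀, hR, hRa⟩ := (hι₁.isPartialIso hι₂ (f := u) (g := u)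
    fun t => (h₁ t).trans (h₂ t).symm).exists_generic (Set.finite_range _)
    (fun x : U.carrier ⊕ U.carrier => {p | Sum.elim (p.1 = ·) (p.2 = ·) x}) (by
      rintro (a | b) R hfin hR
      · obtain ⟨b, hb⟩ := hu.exists_insert hY hpol hfin hR a
        exact ⟨(a, b), rfl, hb⟩
      · obtain ⟨a, ha⟩ := hu.exists_insert hY hpol
          (hfin.preimage Prod.swap_injective.injOn) hR.swap b
        refine ⟨(a, b), rfl, ha.swap.mono ?_⟩
        rintro p (rfl | hp)
        · exact Set.mem_insert _ _
        · exact Set.mem_insert_of_mem _ hp)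
  obtain ⟨h, hh, hhR, hhu⟩ := hR.exists_isEmb fun a => by
    obtain ⟨⟨_, b⟩, rfl, hb⟩ := hRa (Sum.inl a)
    exact ⟨b, hb⟩
  refine ⟨h, ⟨fun b => ?_, hh⟩, fun a => hhR _ (hR₀ ⟨a, rfl⟩), fun t => (hhu t).symm⟩
  obtain ⟨⟨a, _⟩, rfl, hb⟩ := hRa (Sum.inr b)
  exact ⟨a, hhR _ hb⟩

/-! ### Sufficiency: the generic polymorphism -/

/-- A finite partial polymorphism: only the values of `map` on tuples from `dom` matter. -/
structure PartialPol (U : RelStr σ) (n : ℕ) where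
  dom : Set U.carrier
  finite : dom.Finite
  map : (Fin n → U.carrier) → U.carrier
  isHom : IsHom ((U.induced (Subtype.val : dom → U.carrier)).pow n) U
    fun t => map fun i => (t i).val

instance : Preorder (PartialPol U n) where
  le p q := p.dom ⊆ q.dom ∧ ∀ t : Fin n → U.carrier, (∀ i, t i ∈ p.dom) → q.map t = p.map t
  le_refl p := ⟨subset_rfl, fun _ _ => rfl⟩
  le_trans _ _ _ hpq hqr := ⟨hpq.1.trans hqr.1, fun t ht =>
    (hqr.2 t fun i => hpq.1 (ht i)).trans (hpq.2 t ht)⟩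

theorem PartialPol.exists_of_isHom {i : C.carrier → U.carrier} [Finite C.carrier]
    (hi : IsEmb C U i) {h : (Fin n → C.carrier) → U.carrier} (hh : IsHom (C.pow n) U h)
    (v : (Fin n → U.carrier) → U.carrier) :
    ∃ p : PartialPol U n, p.dom = Set.range i ∧ ∀ t, p.map (fun k => i (t k)) = h t := by
  have hinj : Function.Injective fun (t : Fin n → C.carrier) k => i (t k) :=
    hi.1.comp_left
  have key (t : Fin n → C.carrier) :
      Function.extend (fun (t : Fin n → C.carrier) k => i (t k)) h v (fun k => i (t k)) = h t :=
    hinj.extend_apply h v t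
  refine ⟨⟨Set.range i, Set.finite_range i, Function.extend (fun t k => i (t k)) h v, ?_⟩,
    rfl, key⟩
  intro s t ht
  have hc := fun j k => (t j k).2
  choose c hc using hc
  have ht' : (fun j => Function.extend (fun (t : Fin n → C.carrier) k => i (t k)) h v
      fun k => (t j k).val) = fun j => h (c j) := by
    funext j
    rw [← key]
    exact congrArg _ (funext fun k => (hc j k).symm)
  refine ht' ▸ hh s c fun k => (hi.2 s _).2 ?_
  simp only [hc]
  exact ht k

/-- A (countable) code for an instance of the extension property. -/
abbrev ExtensionTask (U : RelStr σ) (n : ℕ) : Type :=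
  Σ m : ℕ, (Fin m → U.carrier) × ((Fin n → Fin m) → U.carrier) × Set (Fin m) ×
    (Fin m → U.carrier)

/-- The finite partial polymorphisms which solve a given extension task. -/
def Solves {m : ℕ} (j : Fin m → U.carrier) (b : (Fin n → Fin m) → U.carrier) (S : Set (Fin m))
    (e : Fin m → U.carrier) : Set (PartialPol U n) :=
  {p | e '' S ⊆ p.dom ∧ (Function.Injective j → IsHom ((U.induced j).pow n) U b →
    IsEmb ((U.induced j).induced (Subtype.val : S → Fin m)) U (fun x => e x.val) →
    (∀ t : Fin n → S, b (fun i => (t i).val) = p.map (fun i => e (t i).val)) →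
    ∃ ι : Fin m → U.carrier, (∀ x, ι x ∈ p.dom) ∧ IsEmb (U.induced j) U ι ∧
      (∀ x ∈ S, ι x = e x) ∧ ∀ t : Fin n → Fin m, b t = p.map fun i => ι (t i))}

theorem PartialPol.exists_le_dom (hU : IsHomogeneous U) (H : HasHAPn (inAge U) n)
    (p : PartialPol U n) {F : Set U.carrier} (hF : F.Finite) :
    ∃ q : PartialPol U n, p ≤ q ∧ F ⊆ q.dom := by
  have hG := p.finite.union hF
  obtain ⟨b, hb, hbp⟩ := exists_hom_extend hU H (inAge_induced p.finite) (inAge_induced hG)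
    ((isEmb_induced_val p.dom).codRestrict fun x => Or.inl x.2) p.isHom
  have : Finite (U.induced (Subtype.val : (p.dom ∪ F : Set _) → U.carrier)).carrier := hG
  obtain ⟨q, hq, hqb⟩ := exists_of_isHom (isEmb_induced_val _) hb p.map
  have hq' : q.dom = p.dom ∪ F := hq.trans Subtype.range_val
  refine ⟨q, ⟨hq' ▸ Set.subset_union_left, fun t ht => ?_⟩, hq' ▸ Set.subset_union_right⟩
  exact (hqb fun i => ⟨t i, Or.inl (ht i)⟩).trans (hbp fun i => ⟨t i, ht i⟩)

theorem PartialPol.exists_le_solves (hU : IsHomogeneous U) (H : HasHAPn (inAge U) n)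
    (H' : HasAEPn (inAge U) n) {m : ℕ} (j : Fin m → U.carrier) (b : (Fin n → Fin m) → U.carrier)
    (S : Set (Fin m)) (e : Fin m → U.carrier) (p : PartialPol U n) :
    ∃ q ∈ Solves j b S e, p ≤ q := by
  obtain ⟨q, hpq, hSq⟩ := p.exists_le_dom hU H (S.toFinite.image e)
  by_cases hc : Function.Injective j ∧ IsHom ((U.induced j).pow n) U b ∧
    IsEmb ((U.induced j).induced (Subtype.val : S → Fin m)) U (fun x => e x.val) ∧
    (∀ t : Fin n → S, b (fun i => (t i).val) = q.map (fun i => e (t i).val))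
  swap
  · exact ⟨q, ⟨hSq, fun h₁ h₂ h₃ h₄ => (hc ⟨h₁, h₂, h₃, h₄⟩).elim⟩, hpq⟩
  obtain ⟨hj, hb, he, hbe⟩ := hc
  have hB : inAge U (U.induced j) := ⟨inferInstanceAs (Finite (Fin m)), j, isEmb_induced hj⟩
  have hS : inAge U ((U.induced j).induced (Subtype.val : S → Fin m)) :=
    hB.mono (inAge_induced (U := U.induced j) S.toFinite)
  obtain ⟨C, g₁, g₂, h, hC, hg₁, hg₂, hg, hh, e₁, e₂⟩ :=
    exists_amalgam_hom hU H' hS (inAge_induced q.finite) hB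
      (he.codRestrict fun x => hSq ⟨x.val, x.2, rfl⟩)
      (isEmb_induced_val (U := U.induced j) S) q.isHom hb (fun t => (hbe t).symm)
  obtain ⟨i, hi, hig⟩ := hU.exists_extend (inAge_induced q.finite) hC hg₁ (isEmb_induced_val _)
  have := hC.1
  obtain ⟨r, hr, hrh⟩ := exists_of_isHom hi hh q.map
  have hqr : q ≤ r := by
    refine ⟨fun x hx => hr ▸ ⟨g₁ ⟨x, hx⟩, hig _⟩, fun t ht => ?_⟩
    have ht' : (fun k => i (g₁ ⟨t k, ht k⟩)) = t := funext fun k => hig _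
    exact (congrArg r.map ht').symm.trans ((hrh _).trans (e₁ fun k => ⟨t k, ht k⟩))
  refine ⟨r, ⟨hSq.trans hqr.1, fun _ _ _ _ => ⟨fun x => i (g₂ x), fun x => hr ▸ ⟨_, rfl⟩,
    hi.comp hg₂, fun x hx => ?_, fun t => ((hrh _).trans (e₂ t)).symm⟩⟩, hpq.trans hqr⟩
  exact (congrArg i (hg ⟨x, hx⟩).symm).trans (hig _)

theorem exists_hasExtension (hn : 0 < n) [Countable U.carrier] (hU : IsHomogeneous U)
    (H : HasHAPn (inAge U) n) (H' : HasAEPn (inAge U) n) :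
    ∃ u : (Fin n → U.carrier) → U.carrier, IsPolymorphism U n u ∧ HasExtension U n u := by
  let p₀ : PartialPol U n := ⟨∅, Set.finite_empty, fun t => t ⟨0, hn⟩, fun s t ht => ht ⟨0, hn⟩⟩
  obtain ⟨s, hs, -, hmeet⟩ := exists_monotone_seq_meeting p₀
    (fun x : ExtensionTask U n ⊕ U.carrier => Sum.elim
      (fun T => Solves T.2.1 T.2.2.1 T.2.2.2.1 T.2.2.2.2) (fun a => {p | a ∈ p.dom}) x) (by
      rintro (T | a) p
      · exact p.exists_le_solves hU H H' _ _ _ _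
      · obtain ⟨q, hpq, hq⟩ := p.exists_le_dom hU H (Set.finite_singleton a)
        exact ⟨q, hq rfl, hpq⟩)
  have hdom : Monotone fun k => (s k).dom := fun k l hkl => (hs hkl).1
  have hcov {ι : Type} [Finite ι] (t : ι → U.carrier) : ∃ k, ∀ i, t i ∈ (s k).dom :=
    exists_forall_mem_of_monotone hdom t fun i => hmeet (Sum.inr (t i))
  choose K hK using fun t : Fin n → U.carrier => hcov t
  let u : (Fin n → U.carrier) → U.carrier := fun t => (s (K t)).map t
  have hu (k : ℕ) (t : Fin n → U.carrier) (ht : ∀ i, t i ∈ (s k).dom) : u t = (s k).map t := by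
    rcases le_total k (K t) with h | h
    · exact (hs h).2 t ht
    · exact ((hs h).2 t (hK t)).symm
  refine ⟨u, fun r t ht => ?_, fun B b S e hB hb he hbe => ?_⟩
  · obtain ⟨k, hk⟩ := hcov fun x : Fin (σ.arity r) × Fin n => t x.1 x.2
    have := (s k).isHom r (fun j i => ⟨t j i, hk (j, i)⟩) ht
    simpa only [hu k (t _) fun i => hk (_, i)] using this
  · obtain ⟨hfin, jB, hjB⟩ := hB
    obtain ⟨m, ⟨φ⟩⟩ := Finite.exists_equiv_fin B.carrier
    let j : Fin m → U.carrier := fun x => jB (φ.symm x)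
    have hφ : IsEmb (U.induced j) B φ.symm := ⟨φ.symm.injective, fun r t => (hjB.2 r _).symm⟩
    have hφ' : IsEmb B (U.induced j) φ := ⟨φ.injective, fun r t =>
      (hjB.2 r t).trans (iff_of_eq (congrArg (· ∈ U.rel r)
        (funext fun i => (congrArg jB (φ.symm_apply_apply (t i))).symm)))⟩
    obtain ⟨k, hk, hsol⟩ := hmeet (Sum.inl ⟨m, j, fun t => b fun i => φ.symm (t i),
      φ.symm ⁻¹' S, fun x => e (φ.symm x)⟩)
    obtain ⟨ι, hιk, hι, hιe, hιb⟩ := hsol (hjB.1.comp φ.symm.injective)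
      (IsHom.comp (B := B.pow n) hb (hφ.isHom.pow n))
      ⟨fun x y hxy => Subtype.ext (φ.symm.injective (congrArg Subtype.val
          (@he.1 ⟨_, x.2⟩ ⟨_, y.2⟩ hxy))),
        fun r t => (hφ.2 r fun i => (t i).val).trans (he.2 r fun i => ⟨_, (t i).2⟩)⟩
      (fun t => (hbe fun i => ⟨_, (t i).2⟩).trans
        (hu k _ fun i => hk ⟨(t i).val, (t i).2, rfl⟩))
    refine ⟨fun x => ι (φ x), hι.comp hφ', fun x hx => ?_, fun t => ?_⟩
    · have := hιe (φ x) (by simpa using hx)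
      simpa using this
    · rw [hu k _ fun i => hιk _]
      have := hιb fun i => φ (t i)
      simpa using this

end RelStr

/-- Let `U` be a countable homogeneous relational structure and `n ≥ 1`.
Then `U` has an `n`-ary universal homogeneous polymorphism if and only if `Age(U)` has
the AEPⁿ and the HAPⁿ. -/
theorem stmt_9 {σ : RelSig} (U : RelStr σ)
    (hc : Countable U.carrier) (hhom : RelStr.IsHomogeneous U)
    (n : ℕ) (hn : 0 < n) :
    (∃ u : (Fin n → U.carrier) → U.carrier,
        IsUniversalPolymorphism U n u ∧ IsHomogeneousPolymorphism U n u) ↔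
      (HasAEPn (RelStr.inAge U) n ∧ HasHAPn (RelStr.inAge U) n) := by
  constructor
  · rintro ⟨u, hu, hu'⟩
    exact ⟨hasAEPn_of_universal_homogeneous hu hu', hasHAPn_of_universal hhom hu⟩
  · rintro ⟨H', H⟩
    obtain ⟨u, hpol, hu⟩ := exists_hasExtension hn hhom H H'
    exact ⟨u, hu.isUniversalPolymorphism hn hpol, hu.isHomogeneousPolymorphism hpol⟩
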